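/- arXiv:2503.01331 — 4 statements merged into one kernel-verified Lean document; each statement's English description precedes it below -/
import Mathlib

section
/- Let 𝒜 be a unital C*-algebra and let σ : ℝ → ℝ → ℝ satisfy the betweenness property: for all reals 0 ≤ x ≤ y, x ≤ σ(x,y) ≤ y. Then for every a ∈ 𝒜, v(a) ≤ ‖a‖_σ ≤ ‖a‖. -/
/-- A state on a unital C*-algebra `A`: a continuous linear functional `f : A → ℂ`
with `f 1 = 1` and `‖f‖ = 1`. -/
def IsState {A : Type*} [CStarAlgebra A] (f : A →L[ℂ] ℂ) : Prop :=
  f 1 = 1 ∧ ‖f‖ = 1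

/-- `‖a‖_σ := sup_{f ∈ S(A)} √(σ(|f(a)|², f(a*a)))`, where `f(a*a)` is the (nonnegative)
real number `(f (star a * a)).re`. -/
noncomputable def sigmaNorm {A : Type*} [CStarAlgebra A] (σ : ℝ → ℝ → ℝ) (a : A) : ℝ :=
  sSup {x : ℝ | ∃ f : A →L[ℂ] ℂ, IsState f ∧
    x = Real.sqrt (σ (‖f a‖ ^ 2) (f (star a * a)).re)}

/-- The algebraic numerical radius `v(a) := sup_{f ∈ S(A)} |f(a)|`. -/
noncomputable def numRadius {A : Type*} [CStarAlgebra A] (a : A) : ℝ :=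
  sSup {x : ℝ | ∃ f : A →L[ℂ] ℂ, IsState f ∧ x = ‖f a‖}

/-- The Crawford number `m(a) := inf_{f ∈ S(A)} |f(a)|`. -/
noncomputable def crawford {A : Type*} [CStarAlgebra A] (a : A) : ℝ :=
  sInf {x : ℝ | ∃ f : A →L[ℂ] ℂ, IsState f ∧ x = ‖f a‖}

/-- `‖a‖_∇ := sup_{f ∈ S(A)} √((|f(a)|² + f(a*a))/2)`. -/
noncomputable def nablaNorm {A : Type*} [CStarAlgebra A] (a : A) : ℝ :=
  sSup {x : ℝ | ∃ f : A →L[ℂ] ℂ, IsState f ∧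
    x = Real.sqrt ((‖f a‖ ^ 2 + (f (star a * a)).re) / 2)}

section State

open Complex ComplexConjugate

variable {A : Type*} [CStarAlgebra A] {f : A →L[ℂ] ℂ}

theorem IsState.norm_apply_le (hf : IsState f) (a : A) : ‖f a‖ ≤ ‖a‖ := by
  simpa [hf.2] using f.le_opNorm a

theorem IsState.map_smul_one (hf : IsState f) (c : ℂ) : f (c • (1 : A)) = c := by
  simp [hf.1]

theorem IsState.im_apply_eq_zero (hf : IsState f) {h : A} (hh : IsSelfAdjoint h) :
    (f h).im = 0 := by
  rcases subsingleton_or_nontrivial A with _ | _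
  · simp [Subsingleton.elim h 0]
  have key (t : ℝ) : ((f h).im + t) ^ 2 ≤ ‖h‖ ^ 2 + t ^ 2 := by
    set b : A := h + (t * I : ℂ) • (1 : A) with hb
    have hsq : star b * b = h * h + (t ^ 2 : ℂ) • (1 : A) := by
      rw [hb, star_add, hh.star_eq, star_smul, star_one]
      simp only [mul_add, add_mul, mul_smul_comm, smul_mul_assoc, mul_one, one_mul]
      have h1 : star (t * I : ℂ) = -(t * I) := by simp
      have h2 : (t * I : ℂ) * (t * I) = -(t ^ 2) := by linear_combination (t ^ 2 : ℂ) * I_sq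
      rw [h1, smul_add, smul_smul, mul_neg, h2]
      module
    have hnorm : ‖b‖ ^ 2 ≤ ‖h‖ ^ 2 + t ^ 2 := by
      rw [sq, ← CStarRing.norm_star_mul_self, hsq]
      refine (norm_add_le _ _).trans ?_
      rw [norm_smul, norm_one, sq ‖h‖]
      gcongr
      · exact norm_mul_le h h
      · simp
    have him : (f b).im = (f h).im + t := by
      rw [hb, map_add, hf.map_smul_one]
      simp
    calc ((f h).im + t) ^ 2 = |(f b).im| ^ 2 := by rw [sq_abs, him]
      _ ≤ ‖b‖ ^ 2 := by
        gcongr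
        exact (abs_im_le_norm _).trans (hf.norm_apply_le b)
      _ ≤ _ := hnorm
  by_contra hne
  have := key (‖h‖ ^ 2 / (f h).im)
  have h2 : ‖h‖ ^ 2 / (f h).im * (f h).im = ‖h‖ ^ 2 := div_mul_cancel₀ _ hne
  have := sq_pos_of_ne_zero hne
  nlinarith [sq_nonneg ‖h‖]

theorem IsState.map_star (hf : IsState f) (a : A) : f (star a) = conj (f a) := by
  have h1 := hf.im_apply_eq_zero (IsSelfAdjoint.add_star_self a)
  have h2 : IsSelfAdjoint (I • (a - star a)) := by
    rw [IsSelfAdjoint, star_smul, star_sub, star_star]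
    simp only [RCLike.star_def, conj_I]
    module
  have h3 := hf.im_apply_eq_zero h2
  simp only [map_add, map_smul, map_sub, add_im, smul_eq_mul, mul_im, I_re, I_im, sub_re,
    zero_mul, one_mul, zero_add] at h1 h3
  apply Complex.ext
  · simp only [conj_re]; linarith
  · simp only [conj_im]; linarith

theorem IsState.re_apply_star_mul_self_nonneg (hf : IsState f) (a : A) :
    0 ≤ (f (star a * a)).re := by
  let _ : PartialOrder A := CStarAlgebra.spectralOrder A
  have _ : StarOrderedRing A := CStarAlgebra.spectralOrderedRing A
  rcases subsingleton_or_nontrivial A with _ | _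
  · simp [Subsingleton.elim a 0]
  set h : A := star a * a
  have h0 : 0 ≤ h := star_mul_self_nonneg a
  have hle : h ≤ algebraMap ℝ A ‖h‖ := (IsSelfAdjoint.of_nonneg h0).le_algebraMap_norm_self
  have hnorm : ‖algebraMap ℝ A ‖h‖ - h‖ ≤ ‖h‖ := by
    have := CStarAlgebra.norm_le_norm_of_nonneg_of_le (sub_nonneg.2 hle) (sub_le_self _ h0)
    simpa using this
  have hf1 : f (algebraMap ℝ A ‖h‖) = ‖h‖ := by
    rw [IsScalarTower.algebraMap_apply ℝ ℂ A, Algebra.algebraMap_eq_smul_one, hf.map_smul_one]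
    simp
  have := (re_le_norm _).trans ((hf.norm_apply_le _).trans hnorm)
  rw [map_sub, hf1, sub_re, ofReal_re] at this
  linarith

theorem IsState.norm_apply_sq_le (hf : IsState f) (a : A) :
    ‖f a‖ ^ 2 ≤ (f (star a * a)).re := by
  have h := hf.re_apply_star_mul_self_nonneg (a - f a • (1 : A))
  have hexp : star (a - f a • (1 : A)) * (a - f a • (1 : A)) =
      star a * a - f a • star a - conj (f a) • a + (conj (f a) * f a) • (1 : A) := by
    simp only [star_sub, star_smul, star_one, sub_mul, mul_sub, mul_smul_comm, smul_mul_assoc,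
      mul_one, one_mul, RCLike.star_def]
    module
  rw [hexp, map_add, map_sub, map_sub, hf.map_smul_one, map_smul, map_smul, hf.map_star] at h
  rw [← normSq_eq_norm_sq, normSq_apply]
  simp only [smul_eq_mul, add_re, sub_re, mul_re, conj_re, conj_im] at h
  linarith

theorem IsState.re_apply_star_mul_self_le (hf : IsState f) (a : A) :
    (f (star a * a)).re ≤ ‖a‖ ^ 2 := by
  rw [sq, ← CStarRing.norm_star_mul_self]
  exact (re_le_norm _).trans (hf.norm_apply_le _)

end State

/-- If `σ` satisfies betweenness (`0 ≤ x ≤ y → x ≤ σ(x,y) ≤ y`), then for every `a`,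
`v(a) ≤ ‖a‖_σ ≤ ‖a‖`. -/
theorem numRadius_le_sigmaNorm_le_norm {A : Type*} [CStarAlgebra A] (σ : ℝ → ℝ → ℝ)
    (hσ : ∀ x y : ℝ, 0 ≤ x → x ≤ y → x ≤ σ x y ∧ σ x y ≤ y) (a : A) :
    numRadius a ≤ sigmaNorm σ a ∧ sigmaNorm σ a ≤ ‖a‖ := by
  have hbetween (f : A →L[ℂ] ℂ) (hf : IsState f) :=
    hσ (‖f a‖ ^ 2) (f (star a * a)).re (sq_nonneg _) (hf.norm_apply_sq_le a)
  have hbound : ∀ x ∈ {x : ℝ | ∃ f : A →L[ℂ] ℂ, IsState f ∧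
      x = Real.sqrt (σ (‖f a‖ ^ 2) (f (star a * a)).re)}, x ≤ ‖a‖ := by
    rintro _ ⟨f, hf, rfl⟩
    exact Real.sqrt_le_iff.2
      ⟨norm_nonneg a, (hbetween f hf).2.trans (hf.re_apply_star_mul_self_le a)⟩
  refine ⟨Real.sSup_le ?_ (Real.sSup_nonneg ?_), Real.sSup_le hbound (norm_nonneg a)⟩
  · rintro _ ⟨f, hf, rfl⟩
    exact (Real.le_sqrt_of_sq_le (hbetween f hf).1).trans (le_csSup ⟨‖a‖, hbound⟩ ⟨f, hf, rfl⟩)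
  · rintro _ ⟨f, -, rfl⟩
    exact Real.sqrt_nonneg _
end

section
/- Let 𝒜 be a unital C*-algebra, let σ : ℝ → ℝ → ℝ be monotone in each argument on nonnegative reals, and let a ∈ 𝒜 be semi-hyponormal, i.e., (aa*)^{1/2} ≤ (a*a)^{1/2} (equivalently |a*| ≤ |a|, where |x| denotes the positive square root of x*x given by continuous functional calculus). Then ‖a‖_σ ≤ ‖ |a| ‖_σ. -/
section

open scoped ComplexOrder

namespace IsState

variable {A : Type*} [CStarAlgebra A] {f : A →L[ℂ] ℂ}

theorem norm_apply_le_s5 (hf : IsState f) (x : A) : ‖f x‖ ≤ ‖x‖ := by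
  simpa [hf.2] using f.le_opNorm x

theorem im_apply_eq_zero_s5 (hf : IsState f) {x : A} (hx : IsSelfAdjoint x) : (f x).im = 0 := by
  have key (t : ℝ) : ((f x).im + t) ^ 2 ≤ ‖x‖ ^ 2 + t ^ 2 := by
    set z : A := x + (t * Complex.I : ℂ) • (1 : A) with hz
    have hfz : (f z).im = (f x).im + t := by simp [hz, hf.1]
    have hzz : star z * z = x * x + ((t ^ 2 : ℝ) : ℂ) • (1 : A) := by
      simp only [hz, star_add, hx.star_eq, star_smul, star_one, add_mul, mul_add,
        smul_mul_assoc, mul_smul_comm, one_mul, mul_one, smul_add, smul_smul]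
      have h1 : star (t * Complex.I : ℂ) = -(t * Complex.I) := by simp
      have h2 : (t * Complex.I : ℂ) * -(t * Complex.I) = ((t ^ 2 : ℝ) : ℂ) := by
        push_cast
        linear_combination (-(t : ℂ) ^ 2) * Complex.I_sq
      simp only [h1, h2]
      module
    have hone : ‖(1 : A)‖ ≤ 1 := by
      nontriviality A
      simp
    calc ((f x).im + t) ^ 2 = |(f z).im| ^ 2 := by rw [hfz, sq_abs]
      _ ≤ ‖z‖ ^ 2 := by
        gcongr
        exact (Complex.abs_im_le_norm _).trans (hf.norm_apply_le_s5 z)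
      _ = ‖x * x + ((t ^ 2 : ℝ) : ℂ) • (1 : A)‖ := by
        rw [← hzz, CStarRing.norm_star_mul_self, sq]
      _ ≤ ‖x‖ * ‖x‖ + t ^ 2 * 1 := by
        refine (norm_add_le _ _).trans (add_le_add (norm_mul_le _ _) ?_)
        rw [norm_smul, Complex.norm_real, Real.norm_of_nonneg (sq_nonneg t)]
        gcongr
      _ = ‖x‖ ^ 2 + t ^ 2 := by ring
  by_contra h
  have h1 := key ((‖x‖ ^ 2) / (f x).im)
  have h2 : (f x).im * (‖x‖ ^ 2 / (f x).im) = ‖x‖ ^ 2 := by field_simp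
  have h3 : 0 < (f x).im ^ 2 := by positivity
  nlinarith [sq_nonneg ‖x‖]

variable [PartialOrder A] [StarOrderedRing A]

theorem apply_nonneg (hf : IsState f) {x : A} (hx : 0 ≤ x) : 0 ≤ f x := by
  rw [Complex.nonneg_iff]
  refine ⟨?_, (hf.im_apply_eq_zero_s5 (.of_nonneg hx)).symm⟩
  have hle : x ≤ algebraMap ℝ A ‖x‖ := IsSelfAdjoint.le_algebraMap_norm_self (.of_nonneg hx)
  have hnorm : ‖algebraMap ℝ A ‖x‖ - x‖ ≤ ‖x‖ := by
    rw [CStarAlgebra.norm_le_iff_le_algebraMap _ (norm_nonneg x) (sub_nonneg.2 hle)]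
    simpa using hx
  have hmap : f (algebraMap ℝ A ‖x‖) = (‖x‖ : ℂ) := by
    rw [Algebra.algebraMap_eq_smul_one, ← Complex.coe_smul, map_smul, hf.1]
    simp
  have h := (Complex.re_le_norm _).trans ((hf.norm_apply_le_s5 _).trans hnorm)
  rw [map_sub, hmap, Complex.sub_re, Complex.ofReal_re] at h
  linarith

/-- A state, regarded as a positive linear functional. -/
noncomputable def toPositiveLinearMap (hf : IsState f) : A →ₚ[ℂ] ℂ :=
  PositiveLinearMap.mk₀ f.toLinearMap fun _ hx => hf.apply_nonneg hx

theorem re_apply_mono (hf : IsState f) {x y : A} (h : x ≤ y) : (f x).re ≤ (f y).re := by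
  have := (Complex.nonneg_iff.1 (hf.apply_nonneg (sub_nonneg.2 h))).1
  simpa using this

/-- The Cauchy–Schwarz inequality for states. -/
theorem norm_apply_star_mul_sq_le (hf : IsState f) (x y : A) :
    ‖f (star x * y)‖ ^ 2 ≤ (f (star x * x)).re * (f (star y * y)).re := by
  let g := hf.toPositiveLinearMap
  have h := norm_inner_le_norm (𝕜 := ℂ) (g.toPreGNS x) (g.toPreGNS y)
  have hsq (z : A) : ‖g.toPreGNS z‖ ^ 2 = (f (star z * z)).re := by
    have := congrArg Complex.re (g.preGNS_norm_sq (g.toPreGNS z))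
    rw [← Complex.ofReal_pow, Complex.ofReal_re] at this
    exact this
  rw [← hsq, ← hsq, ← mul_pow]
  exact pow_le_pow_left₀ (norm_nonneg _) h 2

/-- The mixed Schwarz inequality for states. -/
theorem norm_apply_sq_le_s5 (hf : IsState f) (a : A) :
    ‖f a‖ ^ 2 ≤ (f (CFC.sqrt (a * star a))).re * (f (CFC.sqrt (star a * a))).re := by
  set h := CFC.sqrt (star a * a)
  have h0 : 0 ≤ h := CFC.sqrt_nonneg _
  have hh : h * h = star a * a := CFC.sqrt_mul_sqrt_self _ (star_mul_self_nonneg a)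
  have key (ε : ℝ) (hε : 0 < ε) :
      ‖f a‖ ^ 2 ≤ (f (CFC.sqrt (a * star a))).re * ((f h).re + ε) := by
    set r : A := h + algebraMap ℝ A ε with hr
    have hεpos : IsStrictlyPositive (algebraMap ℝ A ε) := by
      rw [Algebra.algebraMap_eq_smul_one]
      exact IsStrictlyPositive.smul hε isStrictlyPositive_one
    have hrpos : IsStrictlyPositive r := hεpos.nonneg_add h0
    obtain ⟨u, hu⟩ := CFC.isUnit_sqrt_iff_isStrictlyPositive.2 hrpos
    have huu : (u : A) * u = r := by rw [hu]; exact CFC.sqrt_mul_sqrt_self r hrpos.nonneg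
    have husa : star (u : A) = u := by
      rw [hu]; exact (IsSelfAdjoint.of_nonneg (CFC.sqrt_nonneg r)).star_eq
    set q : A := ((u⁻¹ : Aˣ) : A) with hq
    have hqsa : star q = q := by
      have h1 : star u = u := Units.ext husa
      rw [hq, ← Units.coe_star, star_inv, h1]
    have hqq : IsSelfAdjoint (q * q) := by
      rw [IsSelfAdjoint, star_mul, hqsa]
    have hle : h * h ≤ r * r := by
      have : r * r - h * h = (2 * ε) • h + algebraMap ℝ A (ε ^ 2) := by
        simp only [hr, Algebra.algebraMap_eq_smul_one, add_mul, mul_add, smul_mul_assoc,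
          mul_smul_comm, one_mul, mul_one]
        module
      rw [← sub_nonneg, this]
      exact add_nonneg (smul_nonneg (by positivity) h0) (algebraMap_nonneg A (by positivity))
    have hrq : q * q * (r * r) * (q * q) = 1 := by
      rw [← huu]
      simp [hq, mul_assoc]
    have hcontr : q * q * (h * h) * (q * q) ≤ 1 := by
      rw [← hrq]
      exact hqq.conjugate_le_conjugate hle
    have hp0 : 0 ≤ a * (q * q) * star a := by
      have := star_mul_self_nonneg (q * star a)
      simpa [hqsa, mul_assoc] using this
    have hpp : a * (q * q) * star a * (a * (q * q) * star a) ≤ a * star a := by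
      have := star_right_conjugate_le_conjugate hcontr a
      rw [hh] at this
      simpa [mul_assoc] using this
    have hp : a * (q * q) * star a ≤ CFC.sqrt (a * star a) := by
      rw [← CFC.sqrt_mul_self _ hp0]
      exact CFC.sqrt_le_sqrt _ _ hpp
    have hcs := hf.norm_apply_star_mul_sq_le (q * star a) u
    have e1 : star (q * star a) * u = a := by
      rw [star_mul, star_star, hqsa, mul_assoc, Units.inv_mul, mul_one]
    have e2 : star (q * star a) * (q * star a) = a * (q * q) * star a := by
      simp [hqsa, mul_assoc]
    have e3 : (f (star (u : A) * u)).re = (f h).re + ε := by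
      rw [husa, huu, hr, Algebra.algebraMap_eq_smul_one, ← Complex.coe_smul, map_add, map_smul,
        hf.1]
      simp
    rw [e1, e2, e3] at hcs
    have hfh := (Complex.nonneg_iff.1 (hf.apply_nonneg h0)).1
    exact hcs.trans (mul_le_mul_of_nonneg_right (hf.re_apply_mono hp) (by positivity))
  have hlim : Filter.Tendsto (fun ε : ℝ => (f (CFC.sqrt (a * star a))).re * ((f h).re + ε))
      (nhdsWithin 0 (Set.Ioi 0)) (nhds ((f (CFC.sqrt (a * star a))).re * ((f h).re + 0))) :=
    (Continuous.tendsto (by fun_prop) 0).mono_left nhdsWithin_le_nhds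
  rw [add_zero] at hlim
  exact ge_of_tendsto hlim (Filter.eventually_of_mem self_mem_nhdsWithin key)

theorem norm_apply_le_norm_apply_abs (hf : IsState f) {a : A}
    (ha : CFC.sqrt (a * star a) ≤ CFC.sqrt (star a * a)) :
    ‖f a‖ ≤ ‖f (CFC.sqrt (star a * a))‖ := by
  have h0 : 0 ≤ (f (CFC.sqrt (star a * a))).re :=
    (Complex.nonneg_iff.1 (hf.apply_nonneg (CFC.sqrt_nonneg _))).1
  refine le_trans ?_ (Complex.re_le_norm _)
  refine le_of_sq_le_sq ?_ h0
  rw [sq (Complex.re _)]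
  exact (hf.norm_apply_sq_le_s5 a).trans (mul_le_mul_of_nonneg_right (hf.re_apply_mono ha) h0)

end IsState

theorem bddAbove_sigmaNorm {A : Type*} [CStarAlgebra A] [PartialOrder A] [StarOrderedRing A]
    {σ : ℝ → ℝ → ℝ}
    (hσ : ∀ x x' y y' : ℝ, 0 ≤ x → x ≤ x' → 0 ≤ y → y ≤ y' → σ x y ≤ σ x' y') (a : A) :
    BddAbove {x : ℝ | ∃ f : A →L[ℂ] ℂ, IsState f ∧
      x = Real.sqrt (σ (‖f a‖ ^ 2) (f (star a * a)).re)} := by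
  refine ⟨Real.sqrt (σ (‖a‖ ^ 2) ‖star a * a‖), ?_⟩
  rintro _ ⟨f, hf, rfl⟩
  refine Real.sqrt_le_sqrt (hσ _ _ _ _ (by positivity) ?_ ?_ ?_)
  · gcongr
    exact hf.norm_apply_le_s5 a
  · exact (Complex.nonneg_iff.1 (hf.apply_nonneg (star_mul_self_nonneg a))).1
  · exact (Complex.re_le_norm _).trans (hf.norm_apply_le_s5 _)

end

/-- If `σ` is monotone in each argument on nonnegative reals and `a` is semi-hyponormal
(`(aa*)^{1/2} ≤ (a*a)^{1/2}`, i.e. `|a*| ≤ |a|`), then `‖a‖_σ ≤ ‖ |a| ‖_σ`. -/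
theorem sigmaNorm_le_sigmaNorm_abs {A : Type*} [CStarAlgebra A] [PartialOrder A]
    [StarOrderedRing A] (σ : ℝ → ℝ → ℝ)
    (hσ : ∀ x x' y y' : ℝ, 0 ≤ x → x ≤ x' → 0 ≤ y → y ≤ y' → σ x y ≤ σ x' y') (a : A)
    (ha : CFC.sqrt (a * star a) ≤ CFC.sqrt (star a * a)) :
    sigmaNorm σ a ≤ sigmaNorm σ (CFC.sqrt (star a * a)) := by
  set h := CFC.sqrt (star a * a)
  have hh : star h * h = star a * a := by
    rw [(IsSelfAdjoint.of_nonneg (CFC.sqrt_nonneg _)).star_eq]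
    exact CFC.sqrt_mul_sqrt_self _ (star_mul_self_nonneg a)
  refine Real.sSup_le ?_ (Real.sSup_nonneg ?_)
  · rintro _ ⟨f, hf, rfl⟩
    refine le_csSup_of_le (bddAbove_sigmaNorm hσ h) ⟨f, hf, rfl⟩ (Real.sqrt_le_sqrt ?_)
    rw [hh]
    refine hσ _ _ _ _ (by positivity) ?_ ?_ le_rfl
    · gcongr
      exact hf.norm_apply_le_norm_apply_abs ha
    · exact (Complex.nonneg_iff.1 (hf.apply_nonneg (star_mul_self_nonneg a))).1
  · rintro _ ⟨f, -, rfl⟩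
    exact Real.sqrt_nonneg _
end

section
/- Let 𝒜 be a unital C*-algebra. For all a, b ∈ 𝒜, ‖a + b‖_∇ ≤ ‖a‖_∇ + ‖b‖_∇. -/
/-- A state has nonnegative real part on elements of the form `star a * a`. -/
theorem IsState.re_star_mul_self_nonneg {A : Type*} [CStarAlgebra A] {f : A →L[ℂ] ℂ}
    (hf : IsState f) (a : A) : 0 ≤ (f (star a * a)).re := by
  let _ := CStarAlgebra.spectralOrder A
  have _ := CStarAlgebra.spectralOrderedRing A
  have h0 : 0 ≤ star a * a := star_mul_self_nonneg a
  set h := star a * a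
  have hle : h ≤ algebraMap ℝ A ‖h‖ := IsSelfAdjoint.le_algebraMap_norm_self h0.isSelfAdjoint
  have hnorm : ‖algebraMap ℝ A ‖h‖ - h‖ ≤ ‖h‖ := by
    rw [CStarAlgebra.norm_le_iff_le_algebraMap _ (norm_nonneg h) (sub_nonneg.2 hle)]
    exact sub_le_self _ h0
  have hmap : f (algebraMap ℝ A ‖h‖) = (‖h‖ : ℂ) := by
    rw [IsScalarTower.algebraMap_apply ℝ ℂ A, Algebra.algebraMap_eq_smul_one, map_smul, hf.1]
    simp
  have hre := (Complex.re_le_norm _).trans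
    ((f.le_opNorm (algebraMap ℝ A ‖h‖ - h)).trans_eq (by rw [hf.2, one_mul]))
  rw [map_sub, hmap, Complex.sub_re, Complex.ofReal_re] at hre
  linarith

/-- The square root of a nonnegative quadratic expression is subadditive. -/
theorem sqrt_add_add_le_of_forall_quadratic_nonneg {p q c : ℝ} (hp : 0 ≤ p) (hq : 0 ≤ q)
    (h : ∀ t : ℝ, 0 ≤ p * (t * t) + c * t + q) : √(p + c + q) ≤ √p + √q := by
  have hd : c ^ 2 ≤ 4 * p * q := by
    have := discrim_le_zero h
    rw [discrim] at this
    linarith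
  have hc : c ≤ 2 * (√p * √q) := by
    refine le_of_sq_le_sq ?_ (by positivity)
    rw [mul_pow, mul_pow, Real.sq_sqrt hp, Real.sq_sqrt hq]
    linarith
  rw [Real.sqrt_le_left (by positivity), add_sq, Real.sq_sqrt hp, Real.sq_sqrt hq]
  linarith

/-- For a single state, the functional whose supremum is `nablaNorm` is subadditive. -/
theorem IsState.sqrt_nabla_add_le {A : Type*} [CStarAlgebra A] {f : A →L[ℂ] ℂ}
    (hf : IsState f) (a b : A) :
    √((‖f (a + b)‖ ^ 2 + (f (star (a + b) * (a + b))).re) / 2) ≤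
      √((‖f a‖ ^ 2 + (f (star a * a)).re) / 2) + √((‖f b‖ ^ 2 + (f (star b * b)).re) / 2) := by
  have hnn (x : A) : 0 ≤ (‖f x‖ ^ 2 + (f (star x * x)).re) / 2 := by
    have := hf.re_star_mul_self_nonneg x
    positivity
  let c : ℝ := (f a).re * (f b).re + (f a).im * (f b).im +
    ((f (star a * b)).re + (f (star b * a)).re) / 2
  have hexp (t : ℝ) : (‖f ((t : ℂ) • a + b)‖ ^ 2 +
      (f (star ((t : ℂ) • a + b) * ((t : ℂ) • a + b))).re) / 2 =
      (‖f a‖ ^ 2 + (f (star a * a)).re) / 2 * (t * t) + c * t +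
        (‖f b‖ ^ 2 + (f (star b * b)).re) / 2 := by
    simp only [c, Complex.sq_norm, Complex.normSq_apply, star_add, star_smul, add_mul, mul_add,
      smul_mul_assoc, mul_smul_comm, map_add, map_smul, smul_eq_mul, Complex.add_re,
      Complex.add_im, Complex.mul_re, Complex.mul_im, Complex.ofReal_re, Complex.ofReal_im,
      RCLike.star_def, Complex.conj_ofReal]
    ring
  have hone := hexp 1
  rw [Complex.ofReal_one, one_smul, mul_one, mul_one, mul_one] at hone
  rw [hone]
  exact sqrt_add_add_le_of_forall_quadratic_nonneg (hnn a) (hnn b)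
    fun t => (hnn _).trans_eq (hexp t)

/-- The value at a single state is bounded by `nablaNorm`. -/
theorem IsState.sqrt_nabla_le_nablaNorm {A : Type*} [CStarAlgebra A] {f : A →L[ℂ] ℂ}
    (hf : IsState f) (a : A) :
    √((‖f a‖ ^ 2 + (f (star a * a)).re) / 2) ≤ nablaNorm a := by
  refine le_csSup ⟨‖a‖, ?_⟩ ⟨f, hf, rfl⟩
  rintro _ ⟨g, hg, rfl⟩
  have hle (x : A) : ‖g x‖ ≤ ‖x‖ := (g.le_opNorm x).trans_eq (by rw [hg.2, one_mul])
  have h1 : ‖g a‖ ^ 2 ≤ ‖a‖ ^ 2 := pow_le_pow_left₀ (norm_nonneg _) (hle a) 2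
  have h2 := (Complex.re_le_norm _).trans (hle (star a * a))
  rw [CStarRing.norm_star_mul_self] at h2
  rw [Real.sqrt_le_left (norm_nonneg a)]
  linarith

/-- `nablaNorm` is nonnegative, also when there are no states. -/
theorem nablaNorm_nonneg {A : Type*} [CStarAlgebra A] (a : A) : 0 ≤ nablaNorm a := by
  refine Real.sSup_nonneg ?_
  rintro _ ⟨f, -, rfl⟩
  exact Real.sqrt_nonneg _

/-- The triangle inequality for `‖·‖_∇`. -/
theorem nablaNorm_add_le {A : Type*} [CStarAlgebra A] (a b : A) :
    nablaNorm (a + b) ≤ nablaNorm a + nablaNorm b := by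
  refine Real.sSup_le ?_ (add_nonneg (nablaNorm_nonneg a) (nablaNorm_nonneg b))
  rintro _ ⟨f, hf, rfl⟩
  exact (hf.sqrt_nabla_add_le a b).trans
    (add_le_add (hf.sqrt_nabla_le_nablaNorm a) (hf.sqrt_nabla_le_nablaNorm b))
end

section
/- Let 𝒜 be a unital C*-algebra and let a ∈ 𝒜 be self-adjoint with spectrum contained in an interval J ⊆ ℝ. Let φ : J → ℝ be a continuous convex function. Then for every state f on 𝒜, φ(f(a)) ≤ f(φ(a)), where φ(a) is defined by continuous functional calculus; here f(a) is a real number lying in J. If φ is concave, the reverse inequality f(φ(a)) ≤ φ(f(a)) holds. -/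
namespace IsState

variable {A : Type*} [CStarAlgebra A] {a : A} {f : A →L[ℂ] ℂ} {h : ℝ → ℝ}

theorem re_apply_algebraMap (hf : IsState f) (r : ℝ) : (f (algebraMap ℝ A r)).re = r := by
  rw [Algebra.algebraMap_eq_smul_one, ← Complex.coe_smul, map_smul, hf.1]
  simp

theorem re_cfc_nonneg (hf : IsState f) (ha : IsSelfAdjoint a)
    (hc : ContinuousOn h (spectrum ℝ a)) (h_nonneg : ∀ x ∈ spectrum ℝ a, 0 ≤ h x) :
    0 ≤ (f (cfc h a)).re := by
  obtain ⟨C, hC⟩ := (spectrum.isCompact (𝕜 := ℝ) a).exists_bound_of_continuousOn hc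
  have h_norm : ‖cfc (fun x ↦ |C| - h x) a‖ ≤ |C| := by
    refine norm_cfc_le (abs_nonneg C) fun x hx ↦ ?_
    have h1 := h_nonneg x hx
    have h2 := (le_abs_self (h x)).trans ((hC x hx).trans (le_abs_self C))
    rw [Real.norm_eq_abs, abs_le]
    constructor <;> linarith
  have h_sub : cfc (fun x ↦ |C| - h x) a = algebraMap ℝ A |C| - cfc h a := by
    rw [cfc_sub (fun _ ↦ |C|) h a, cfc_const |C| a]
  have h_le := (Complex.re_le_norm _).trans (f.le_opNorm (cfc (fun x ↦ |C| - h x) a))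
  rw [hf.2, one_mul] at h_le
  have h_le' := h_le.trans h_norm
  rw [h_sub, map_sub, Complex.sub_re, hf.re_apply_algebraMap] at h_le'
  linarith

theorem affine_le_re_cfc (hf : IsState f) (ha : IsSelfAdjoint a)
    (hc : ContinuousOn h (spectrum ℝ a)) {c d : ℝ}
    (h_le : ∀ x ∈ spectrum ℝ a, c * x + d ≤ h x) :
    c * (f a).re + d ≤ (f (cfc h a)).re := by
  have h_nonneg := hf.re_cfc_nonneg (h := fun x ↦ h x - (c * x + d)) ha (by fun_prop)
    fun x hx ↦ sub_nonneg.2 (h_le x hx)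
  have h_affine : cfc (fun x ↦ c * x + d) a = c • a + algebraMap ℝ A d := by
    rw [cfc_add_const d (fun x ↦ c * x) a, cfc_const_mul_id c a]
  have h_smul : (f (c • a)).re = c * (f a).re := by
    rw [← Complex.coe_smul, map_smul]
    simp
  rw [cfc_sub h (fun x ↦ c * x + d) a, h_affine, map_sub, map_add, Complex.sub_re,
    Complex.add_re, hf.re_apply_algebraMap, h_smul] at h_nonneg
  linarith

theorem re_apply_mem_Icc (hf : IsState f) (ha : IsSelfAdjoint a) {m M : ℝ}
    (h_spec : spectrum ℝ a ⊆ Set.Icc m M) : (f a).re ∈ Set.Icc m M := by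
  constructor
  · have := hf.affine_le_re_cfc (h := fun x ↦ x) (c := 0) (d := m) ha (by fun_prop)
      fun x hx ↦ by simpa using (h_spec hx).1
    rw [cfc_id' ℝ a] at this
    linarith
  · have := hf.affine_le_re_cfc (h := fun _ ↦ M) (c := 1) (d := 0) ha (by fun_prop)
      fun x hx ↦ by simpa using (h_spec hx).2
    rw [cfc_const M a, hf.re_apply_algebraMap] at this
    linarith

theorem map_re_le_re_cfc (hf : IsState f) (ha : IsSelfAdjoint a) {J : Set ℝ}
    (h_spec : spectrum ℝ a ⊆ J) (hc : ContinuousOn h J) (h_convex : ConvexOn ℝ J h) :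
    h (f a).re ≤ (f (cfc h a)).re := by
  have : Nontrivial A := ⟨1, 0, fun h10 ↦ by simpa [h10] using hf.1⟩
  have h_compact := spectrum.isCompact (𝕜 := ℝ) a
  have h_nonempty : (spectrum ℝ a).Nonempty :=
    ContinuousFunctionalCalculus.spectrum_nonempty (R := ℝ) a ha
  obtain ⟨m, hm, h_min⟩ := h_compact.exists_isLeast h_nonempty
  obtain ⟨M, hM, h_max⟩ := h_compact.exists_isGreatest h_nonempty
  have h_sub : spectrum ℝ a ⊆ Set.Icc m M := fun x hx ↦ ⟨h_min hx, h_max hx⟩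
  have h_Icc : Set.Icc m M ⊆ J := h_convex.1.ordConnected.out (h_spec hm) (h_spec hM)
  refine le_of_forall_lt fun r hr ↦ ?_
  obtain ⟨r', hr', hr'_lt⟩ := exists_between hr
  obtain ⟨c, d, h_le, h_eq⟩ :=
    (h_convex.subset h_Icc (convex_Icc m M)).exists_affine_le_of_lt_real
      (hf.re_apply_mem_Icc ha h_sub) hr'_lt isClosed_Icc (hc.mono h_Icc).lowerSemicontinuousOn
  exact hr'.trans_le <| h_eq ▸
    hf.affine_le_re_cfc ha (hc.mono h_spec) fun x hx ↦ h_le x (h_sub hx)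

end IsState

/-- Jensen-type inequality for states: if `a` is self-adjoint with spectrum in an interval `J`
and `φ : J → ℝ` is continuous, then `φ(f(a)) ≤ f(φ(a))` when `φ` is convex, and the reverse
inequality holds when `φ` is concave. -/
theorem state_jensen {A : Type*} [CStarAlgebra A] (a : A) (ha : IsSelfAdjoint a)
    (J : Set ℝ) (hJ : J.OrdConnected) (hspec : spectrum ℝ a ⊆ J)
    (φ : ℝ → ℝ) (hφc : ContinuousOn φ J) (f : A →L[ℂ] ℂ) (hf : IsState f) :
    (ConvexOn ℝ J φ → φ ((f a).re) ≤ (f (cfc φ a)).re) ∧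
    (ConcaveOn ℝ J φ → (f (cfc φ a)).re ≤ φ ((f a).re)) := by
  refine ⟨hf.map_re_le_re_cfc ha hspec hφc, fun h_concave ↦ ?_⟩
  have h_neg := hf.map_re_le_re_cfc ha hspec hφc.neg h_concave.neg
  have h_cfc : cfc (-φ) a = -cfc φ a := cfc_neg φ a
  rw [h_cfc, map_neg, Complex.neg_re, Pi.neg_apply] at h_neg
  exact neg_le_neg_iff.1 h_neg
end
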